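/- (i) If x ∈ [0, ρ], then for any r with max{x, ρ−x} ≤ r ≤ 1−x one has μ(B(x,r))/(2r)^s ≤ ρ^s/(2^s (ρ−x)^s) when x ∈ [0, ρ/2], and μ(B(x,r))/(2r)^s ≤ max{ρ^s/(2^s x^s), 1/(2^s (1−x)^s)} when x ∈ [ρ/2, ρ]; in each case the bound is attained for some admissible r. (ii) If x ∈ [1−ρ, 1], then for any r with max{1−x, ρ−(1−x)} ≤ r ≤ x one has μ(B(x,r))/(2r)^s ≤ max{ρ^s/(2^s (1−x)^s), 1/(2^s x^s)} when x ∈ [1−ρ, 1−ρ/2], and μ(B(x,r))/(2r)^s ≤ ρ^s/(2^s (ρ−(1−x))^s) when x ∈ [1−ρ/2, 1]; in each case the bound is attained for some admissible r. -/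

import Mathlib

open MeasureTheory Filter Set Topology ENNReal

namespace HomogeneousCantorDensity

noncomputable def R (N : ℕ) (ρ : ℝ) : ℝ := (1 - ρ) / ((N : ℝ) - 1)

noncomputable def f (N : ℕ) (ρ : ℝ) (i : ℕ) (x : ℝ) : ℝ := ρ * x + (i : ℝ) * R N ρ

noncomputable def piMap (N : ℕ) (ρ : ℝ) (d : ℕ → ℕ) : ℝ :=
  R N ρ * ∑' i : ℕ, (d i : ℝ) * ρ ^ i

def cantorE (N : ℕ) (ρ : ℝ) : Set ℝ :=
  {x | ∃ d : ℕ → ℕ, (∀ i, d i < N) ∧ x = piMap N ρ d}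

/-- `μ = ∑_{i=0}^{N-1} (1/N) μ ∘ f_i⁻¹`. -/
def IsSelfSimilar (N : ℕ) (ρ : ℝ) (μ : Measure ℝ) : Prop :=
  μ = ∑ i ∈ Finset.range N, (N : ℝ≥0∞)⁻¹ • μ.map (f N ρ i)

/-- `T^n x` for `x = piMap N ρ d`. -/
noncomputable def Tn (N : ℕ) (ρ : ℝ) (d : ℕ → ℕ) (n : ℕ) : ℝ :=
  piMap N ρ (fun i => d (n + i))

/-- pointwise lower `s`-density of `μ` at `x`. -/
noncomputable def lowerDensity (μ : Measure ℝ) (s x : ℝ) : ℝ :=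
  liminf (fun r : ℝ => (μ (Ioo (x - r) (x + r))).toReal / (2 * r) ^ s) (𝓝[>] 0)

/-- pointwise upper `s`-density of `μ` at `x`. -/
noncomputable def upperDensity (μ : Measure ℝ) (s x : ℝ) : ℝ :=
  limsup (fun r : ℝ => (μ (Ioo (x - r) (x + r))).toReal / (2 * r) ^ s) (𝓝[>] 0)

lemma selfsim_real {N : ℕ} {ρ : ℝ} {μ : Measure ℝ} [IsProbabilityMeasure μ]
    (hss : IsSelfSimilar N ρ μ) {A : Set ℝ} (hA : MeasurableSet A) :
    μ.real A = (N : ℝ)⁻¹ * ∑ i ∈ Finset.range N, μ.real (f N ρ i ⁻¹' A) := by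
  have hm : ∀ i, Measurable (f N ρ i) := by
    intro i; unfold f; fun_prop
  have h : μ A = ∑ i ∈ Finset.range N, (N : ℝ≥0∞)⁻¹ * μ (f N ρ i ⁻¹' A) := by
    conv_lhs => rw [show μ = _ from hss]
    rw [Measure.finsetSum_apply]
    refine Finset.sum_congr rfl fun i _ => ?_
    rw [Measure.smul_apply, Measure.map_apply (hm i) hA, smul_eq_mul]
  by_cases hN : N = 0
  · subst hN
    simp [Measure.real, h]
  rw [Measure.real, h, ENNReal.toReal_sum, Finset.mul_sum]
  · refine Finset.sum_congr rfl fun i _ => ?_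
    simp [ENNReal.toReal_mul, Measure.real]
  · intro i _
    refine ENNReal.mul_ne_top ?_ (measure_ne_top _ _)
    simp [hN]

lemma R_facts {N : ℕ} (hN : 2 ≤ N) {ρ : ℝ} (hρ0 : 0 < ρ) (hρ1 : ρ ≤ 1 / (N : ℝ) ^ 2) :
    ρ * (N : ℝ) ^ 2 ≤ 1 ∧ 2 * ρ ≤ R N ρ ∧ ((N : ℝ) - 1) * R N ρ = 1 - ρ ∧
      1 ≤ (N : ℝ) * R N ρ ∧ ρ ≤ 1 / 4 := by
  have hN' : (2 : ℝ) ≤ N := by exact_mod_cast hN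
  have h1 : ρ * (N : ℝ) ^ 2 ≤ 1 := by
    rwa [le_div_iff₀ (by positivity)] at hρ1
  have h3 : ((N : ℝ) - 1) * R N ρ = 1 - ρ := by
    unfold R; field_simp [show (N : ℝ) - 1 ≠ 0 by linarith]
  have h4N : (4 : ℝ) ≤ (N : ℝ) ^ 2 := by nlinarith
  refine ⟨h1, ?_, h3, ?_, by nlinarith⟩
  · unfold R
    rw [le_div_iff₀ (by linarith)]
    nlinarith
  · unfold R
    rw [mul_div_assoc', le_div_iff₀ (by linarith)]
    nlinarith

lemma real_Iic_zero {N : ℕ} (hN : 2 ≤ N) {ρ : ℝ} (hρ0 : 0 < ρ) (hρ1 : ρ ≤ 1 / (N : ℝ) ^ 2)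
    {μ : Measure ℝ} [IsProbabilityMeasure μ] (hss : IsSelfSimilar N ρ μ) :
    μ.real (Iic 0) = 0 := by
  obtain ⟨h1, h2, h3, h4, h5⟩ := R_facts hN hρ0 hρ1
  have hN' : (2 : ℝ) ≤ N := by exact_mod_cast hN
  have hpre : ∀ y i, f N ρ i ⁻¹' (Iic y) = Iic ((y - i * R N ρ) / ρ) := by
    intro y i; ext z
    simp only [f, mem_preimage, mem_Iic]
    rw [le_div_iff₀ hρ0]
    constructor <;> intro h <;> linarith
  have hG : ∀ y, μ.real (Iic y) =
      (N : ℝ)⁻¹ * ∑ i ∈ Finset.range N, μ.real (Iic ((y - i * R N ρ) / ρ)) := by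
    intro y
    rw [selfsim_real hss measurableSet_Iic]
    simp_rw [hpre]
  have hmono : ∀ {a b : ℝ}, a ≤ b → μ.real (Iic a) ≤ μ.real (Iic b) := fun hab =>
    measureReal_mono (Iic_subset_Iic.2 hab)
  have hstep : ∀ y, μ.real (Iic y) ≤ μ.real (Iic (y / ρ)) := by
    intro y
    rw [hG y]
    have : ∑ i ∈ Finset.range N, μ.real (Iic ((y - i * R N ρ) / ρ)) ≤
        ∑ i ∈ Finset.range N, μ.real (Iic (y / ρ)) := by
      refine Finset.sum_le_sum fun i _ => hmono ?_
      have : 0 ≤ (i : ℝ) * R N ρ := mul_nonneg (by positivity) (by linarith)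
      gcongr
      linarith
    rw [Finset.sum_const, Finset.card_range, nsmul_eq_mul] at this
    rw [inv_mul_le_iff₀ (by linarith)]
    exact this
  have hneg : ∀ y < 0, μ.real (Iic y) = 0 := by
    intro y hy
    have hit : ∀ n : ℕ, μ.real (Iic y) ≤ μ.real (Iic (y * (ρ⁻¹) ^ n)) := by
      intro n
      induction n with
      | zero => simp
      | succ n ih =>
        refine ih.trans ((hstep _).trans (le_of_eq ?_))
        rw [pow_succ, div_eq_mul_inv, mul_assoc]
    have ht : Tendsto (fun n : ℕ => y * (ρ⁻¹) ^ n) atTop atBot := by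
      refine Tendsto.const_mul_atTop_of_neg hy (tendsto_pow_atTop_atTop_of_one_lt ?_)
      rw [one_lt_inv₀ hρ0]; linarith
    have ht2 := (ProbabilityTheory.tendsto_cdf_atBot μ).comp ht
    have : μ.real (Iic y) ≤ 0 := by
      refine ge_of_tendsto' ht2 fun n => ?_
      simp only [Function.comp, ProbabilityTheory.cdf_eq_real]
      exact hit n
    exact le_antisymm this measureReal_nonneg
  have h0 := hG 0
  rw [Finset.sum_eq_single 0] at h0
  · simp only [Nat.cast_zero, zero_mul, sub_zero, zero_div] at h0
    have h6 : (N : ℝ)⁻¹ ≤ 1 / 2 := by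
      rw [inv_le_comm₀ (by linarith) (by norm_num)]; norm_num; exact hN
    have h7 : 0 ≤ μ.real (Iic (0 : ℝ)) := measureReal_nonneg
    nlinarith
  · intro i _ hi
    apply hneg
    have : (1 : ℝ) ≤ i := by exact_mod_cast Nat.one_le_iff_ne_zero.2 hi
    have : 0 < (i : ℝ) * R N ρ := mul_pos (by linarith) (by linarith)
    apply div_neg_of_neg_of_pos _ hρ0
    linarith
  · intro h; simp at h; omega

lemma selfsim_reflect {N : ℕ} (hN : 2 ≤ N) {ρ : ℝ}
    {μ : Measure ℝ} (hss : IsSelfSimilar N ρ μ) :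
    IsSelfSimilar N ρ (μ.map (fun x => 1 - x)) := by
  have hN' : (2 : ℝ) ≤ N := by exact_mod_cast hN
  have h3 : ((N : ℝ) - 1) * R N ρ = 1 - ρ := by
    unfold R; field_simp [show (N : ℝ) - 1 ≠ 0 by linarith]
  have hm : ∀ i, Measurable (f N ρ i) := by
    intro i; unfold f; fun_prop
  have hr : Measurable (fun x : ℝ => 1 - x) := by fun_prop
  unfold IsSelfSimilar
  ext A hA
  rw [Measure.map_apply hr hA]
  conv_lhs => rw [show μ = _ from hss]
  rw [Measure.finsetSum_apply, Measure.finsetSum_apply, ← Finset.sum_range_reflect]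
  refine Finset.sum_congr rfl fun i hi => ?_
  rw [Finset.mem_range] at hi
  rw [Measure.smul_apply, Measure.smul_apply, Measure.map_apply (hm _) (hr hA),
    Measure.map_apply (hm _) hA, Measure.map_apply hr (hm _ hA)]
  congr 2
  ext z
  simp only [mem_preimage, f]
  have : ((N - 1 - i : ℕ) : ℝ) = (N : ℝ) - 1 - i := by
    rw [Nat.cast_sub (by omega), Nat.cast_sub (by omega)]; simp
  rw [this]
  have e : 1 - (ρ * z + ((N : ℝ) - 1 - i) * R N ρ) = ρ * (1 - z) + i * R N ρ := by
    linear_combination -h3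
  rw [e]

/-- The facts on the distribution function that are used below. -/
structure Dist (N : ℕ) (ρ : ℝ) (F : ℝ → ℝ) : Prop where
  le_one : ∀ y, F y ≤ 1
  zero : ∀ y, y ≤ 0 → F y = 0
  one : ∀ y, 1 ≤ y → F y = 1
  eq : ∀ y, F y = (N : ℝ)⁻¹ * ∑ i ∈ Finset.range N, F ((y - i * R N ρ) / ρ)

lemma dist_of_selfsim {N : ℕ} (hN : 2 ≤ N) {ρ : ℝ} (hρ0 : 0 < ρ) (hρ1 : ρ ≤ 1 / (N : ℝ) ^ 2)
    {μ : Measure ℝ} [IsProbabilityMeasure μ] (hss : IsSelfSimilar N ρ μ) :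
    Dist N ρ (fun y => μ.real (Iio y)) := by
  have h0 := real_Iic_zero hN hρ0 hρ1 hss
  have hr : Measurable (fun x : ℝ => 1 - x) := by fun_prop
  have : IsProbabilityMeasure (μ.map (fun x => 1 - x)) :=
    Measure.isProbabilityMeasure_map hr.aemeasurable
  have h1 := real_Iic_zero hN hρ0 hρ1 (selfsim_reflect hN hss)
  rw [map_measureReal_apply hr measurableSet_Iic] at h1
  have e : (fun x : ℝ => 1 - x) ⁻¹' (Iic 0) = (Iio 1)ᶜ := by
    ext z; simp
  rw [e, probReal_compl_eq_one_sub measurableSet_Iio] at h1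
  refine ⟨fun y => measureReal_le_one, fun y hy => ?_, fun y hy => ?_, fun y => ?_⟩
  · refine le_antisymm ?_ measureReal_nonneg
    rw [← h0]
    exact measureReal_mono fun z hz => le_of_lt (lt_of_lt_of_le hz hy)
  · refine le_antisymm measureReal_le_one ?_
    have : μ.real (Iio 1) ≤ μ.real (Iio y) := measureReal_mono (Iio_subset_Iio hy)
    linarith
  · have hpre : ∀ i, f N ρ i ⁻¹' (Iio y) = Iio ((y - i * R N ρ) / ρ) := by
      intro i; ext z
      simp only [f, mem_preimage, mem_Iio]
      rw [lt_div_iff₀ hρ0]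
      constructor <;> intro h <;> linarith
    show μ.real (Iio y) = _
    rw [selfsim_real hss measurableSet_Iio]
    simp_rw [hpre]

lemma Dist.step {N : ℕ} (hN : 2 ≤ N) {ρ : ℝ} (hρ0 : 0 < ρ) (hρ1 : ρ ≤ 1 / (N : ℝ) ^ 2)
    {F : ℝ → ℝ} (hF : Dist N ρ F) {k : ℕ} (hk : k < N) {y : ℝ} (hy : y ≤ (k + 1) * R N ρ) :
    F y ≤ k / N + F ((y - k * R N ρ) / ρ) / N := by
  obtain ⟨h1, h2, h3, h4, h5⟩ := R_facts hN hρ0 hρ1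
  have hN' : (2 : ℝ) ≤ N := by exact_mod_cast hN
  rw [hF.eq y]
  have hsub : Finset.range (k + 1) ⊆ Finset.range N := by
    intro i; simp only [Finset.mem_range]; omega
  rw [← Finset.sum_subset hsub, Finset.sum_range_succ]
  · have : ∑ i ∈ Finset.range k, F ((y - i * R N ρ) / ρ) ≤ ∑ i ∈ Finset.range k, (1 : ℝ) :=
      Finset.sum_le_sum fun i _ => hF.le_one _
    simp only [Finset.sum_const, Finset.card_range, nsmul_eq_mul, mul_one] at this
    rw [← _root_.add_div, _root_.div_eq_inv_mul _ (N : ℝ)]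
    exact mul_le_mul_of_nonneg_left (by linarith) (by positivity)
  · intro i _ hi
    simp only [Finset.mem_range, not_lt] at hi
    apply hF.zero
    have : (k : ℝ) + 1 ≤ i := by exact_mod_cast hi
    apply div_nonpos_of_nonpos_of_nonneg _ hρ0.le
    have := mul_le_mul_of_nonneg_right this (show 0 ≤ R N ρ by linarith)
    linarith

lemma Dist.crude {N : ℕ} (hN : 2 ≤ N) {ρ : ℝ} (hρ0 : 0 < ρ) (hρ1 : ρ ≤ 1 / (N : ℝ) ^ 2)
    {F : ℝ → ℝ} (hF : Dist N ρ F) {k : ℕ} (hk : k < N) {y : ℝ} (hy : y ≤ (k + 1) * R N ρ) :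
    F y ≤ (k + 1) / N := by
  have := hF.step hN hρ0 hρ1 hk hy
  have h1 : F ((y - k * R N ρ) / ρ) / N ≤ 1 / N := by
    gcongr; exact hF.le_one _
  rw [add_div]; linarith

lemma Dist.first {N : ℕ} (hN : 2 ≤ N) {ρ : ℝ} (hρ0 : 0 < ρ) (hρ1 : ρ ≤ 1 / (N : ℝ) ^ 2)
    {F : ℝ → ℝ} (hF : Dist N ρ F) {y : ℝ} (hy0 : ρ ≤ y) (hy : y ≤ R N ρ) :
    F y = 1 / N := by
  rw [hF.eq y, Finset.sum_eq_single 0]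
  · rw [hF.one]
    · simp
    · rw [le_div_iff₀ hρ0]; simpa using hy0
  · intro i _ hi
    apply hF.zero
    apply div_nonpos_of_nonpos_of_nonneg _ hρ0.le
    have : (1 : ℝ) ≤ i := by exact_mod_cast Nat.one_le_iff_ne_zero.2 hi
    nlinarith
  · intro h; simp at h; omega

lemma s_facts {N : ℕ} (hN : 2 ≤ N) {ρ : ℝ} (hρ0 : 0 < ρ) (hρ1 : ρ ≤ 1 / (N : ℝ) ^ 2)
    {s : ℝ} (hs : s = -Real.log N / Real.log ρ) : 0 < s ∧ s ≤ 1 / 2 ∧ ρ ^ s = 1 / N := by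
  have hN' : (2 : ℝ) ≤ N := by exact_mod_cast hN
  have hl : 0 < Real.log N := Real.log_pos (by linarith)
  have hl2 : Real.log ρ ≤ -(2 * Real.log N) := by
    have := Real.log_le_log hρ0 hρ1
    rw [one_div, Real.log_inv, Real.log_pow] at this
    exact_mod_cast this
  refine ⟨?_, ?_, ?_⟩
  · rw [hs]; exact div_pos_of_neg_of_neg (by linarith) (by linarith)
  · rw [hs, div_le_iff_of_neg (by linarith)]; linarith
  · rw [Real.rpow_def_of_pos hρ0, hs, mul_div_cancel₀ _ (by linarith), Real.exp_neg,
      Real.exp_log (by linarith), one_div]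

lemma le_rpow_of_sq {a b s : ℝ} (ha : 0 ≤ a) (hb0 : 0 < b) (hb1 : b ≤ 1) (hab : a ^ 2 ≤ b)
    (hs : s ≤ 1 / 2) : a ≤ b ^ s := by
  calc a ≤ √b := Real.le_sqrt_of_sq_le hab
    _ = b ^ (1 / 2 : ℝ) := Real.sqrt_eq_rpow b
    _ ≤ b ^ s := Real.rpow_le_rpow_of_exponent_ge hb0 hb1 hs

lemma concave_bound {N : ℕ} (hN : 2 ≤ N) {s t l : ℝ} (hs0 : 0 < s) (hs : s ≤ 1 / 2)
    (ht0 : 0 ≤ t) (ht1 : t ≤ 1) (hl0 : 0 ≤ l) (hl : l ≤ 1 / N) :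
    ((N : ℝ) - 1) / N + t ^ s / N ≤ ((1 - l) + l * t) ^ s := by
  have hN' : (2 : ℝ) ≤ N := by exact_mod_cast hN
  have hl1 : l ≤ 1 := hl.trans (by rw [div_le_one (by linarith)]; linarith)
  have hc := (Real.concaveOn_rpow hs0.le (by linarith : s ≤ 1)).2 (show (1 : ℝ) ∈ Ici 0 by simp)
    (show t ∈ Ici 0 from ht0) (show 0 ≤ 1 - l by linarith) hl0 (by ring)
  simp only [smul_eq_mul, Real.one_rpow, mul_one] at hc
  refine le_trans ?_ hc
  have h1 : t ^ s ≤ 1 := Real.rpow_le_one ht0 ht1 hs0.le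
  have e : ((N : ℝ) - 1) / N + t ^ s / N = 1 - (1 / N) * (1 - t ^ s) := by
    field_simp; ring
  rw [e]
  nlinarith

/-- locate the level-one index of `y` -/
lemma exists_index {N : ℕ} (hN : 2 ≤ N) {ρ : ℝ} (hρ0 : 0 < ρ) (hρ1 : ρ ≤ 1 / (N : ℝ) ^ 2)
    {y : ℝ} (hy0 : 0 ≤ y) (hy1 : y ≤ 1) :
    ∃ k : ℕ, k < N ∧ k * R N ρ ≤ y ∧ y ≤ (k + 1) * R N ρ := by
  obtain ⟨h1, h2, h3, h4, h5⟩ := R_facts hN hρ0 hρ1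
  have hR : 0 < R N ρ := by linarith
  by_cases h : y / R N ρ < N
  · refine ⟨⌊y / R N ρ⌋₊, ?_, ?_, ?_⟩
    · rwa [Nat.floor_lt (by positivity)]
    · rw [← le_div_iff₀ hR]; exact Nat.floor_le (by positivity)
    · rw [← div_le_iff₀ hR]; exact (Nat.lt_floor_add_one _).le
  · rw [not_lt, le_div_iff₀ hR] at h
    have : ((N - 1 : ℕ) : ℝ) = (N : ℝ) - 1 := by rw [Nat.cast_sub (by omega)]; simp
    refine ⟨N - 1, by omega, ?_, ?_⟩
    · rw [this]; linarith
    · rw [this]; linarith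

lemma Dist.le_rpow_approx {N : ℕ} (hN : 2 ≤ N) {ρ : ℝ} (hρ0 : 0 < ρ)
    (hρ1 : ρ ≤ 1 / (N : ℝ) ^ 2) {s : ℝ} (hs0 : 0 < s) (hs : s ≤ 1 / 2) (hρs : ρ ^ s = 1 / N)
    {F : ℝ → ℝ} (hF : Dist N ρ F) (n : ℕ) :
    ∀ y, 0 ≤ y → y ≤ 1 → F y ≤ y ^ s + (1 / (N : ℝ)) ^ n := by
  obtain ⟨h1, h2, h3, h4, h5⟩ := R_facts hN hρ0 hρ1
  have hN' : (2 : ℝ) ≤ N := by exact_mod_cast hN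
  have hN0 : (0 : ℝ) < N := by linarith
  have hR : 0 < R N ρ := by linarith
  induction n with
  | zero =>
    intro y hy0 _
    have := Real.rpow_nonneg hy0 s
    have := hF.le_one y
    rw [pow_zero]; linarith
  | succ n ih =>
    intro y hy0 hy1
    have hε : 0 ≤ (1 / (N : ℝ)) ^ (n + 1) := by positivity
    obtain ⟨k, hk, hk0, hk1⟩ := exists_index hN hρ0 hρ1 hy0 hy1
    have hst := hF.step hN hρ0 hρ1 hk hk1
    have hcr := hF.crude hN hρ0 hρ1 hk hk1
    rcases Nat.eq_zero_or_pos k with rfl | hkpos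
    · simp only [Nat.cast_zero, zero_mul, sub_zero, zero_div, zero_add] at hst hcr
      rcases le_total y ρ with hyρ | hyρ
      · have ht := ih (y / ρ) (by positivity) (by rw [div_le_one hρ0]; exact hyρ)
        rw [Real.div_rpow hy0 hρ0.le, hρs] at ht
        calc F y ≤ F (y / ρ) / N := hst
          _ ≤ (y ^ s / (1 / N) + (1 / (N : ℝ)) ^ n) / N := by gcongr
          _ = _ := by rw [pow_succ]; field_simp
      · have := Real.rpow_le_rpow hρ0.le hyρ hs0.le
        linarith
    · have hkr : (1 : ℝ) ≤ k := by exact_mod_cast hkpos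
      by_cases hkl : k = N - 1
      · have hkc : (k : ℝ) = (N : ℝ) - 1 := by
          rw [hkl, Nat.cast_sub (by omega)]; simp
        rw [hkc, h3] at hst hk0
        have ht0 : 0 ≤ (y - (1 - ρ)) / ρ := div_nonneg (by linarith) hρ0.le
        have ht1 : (y - (1 - ρ)) / ρ ≤ 1 := by rw [div_le_one hρ0]; linarith
        have ht := ih _ ht0 ht1
        have hc := concave_bound hN hs0 hs ht0 ht1 hρ0.le
          (show ρ ≤ 1 / N by rw [le_div_iff₀ hN0]; nlinarith)
        have e : 1 - ρ + ρ * ((y - (1 - ρ)) / ρ) = y := by field_simp; ring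
        rw [e] at hc
        have : F ((y - (1 - ρ)) / ρ) / N ≤
          ((y - (1 - ρ)) / ρ) ^ s / N + (1 / (N : ℝ)) ^ (n + 1) := by
          calc _ ≤ (((y - (1 - ρ)) / ρ) ^ s + (1 / (N : ℝ)) ^ n) / N := by gcongr
            _ = _ := by rw [pow_succ]; field_simp
        linarith
      · have hk2 : (k : ℝ) + 2 ≤ N := by
          have : k + 2 ≤ N := by omega
          exact_mod_cast this
        have hy' : 0 < y := lt_of_lt_of_le (by positivity) hk0
        have : ((k : ℝ) + 1) / N ≤ y ^ s := by
          refine le_rpow_of_sq (by positivity) hy' hy1 (le_trans ?_ hk0) hs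
          have hRl : ((N : ℝ) + 1) / N ^ 2 ≤ R N ρ := by
            unfold R
            rw [div_le_div_iff₀ (by positivity) (by linarith)]
            nlinarith
          calc (((k : ℝ) + 1) / N) ^ 2 = ((k : ℝ) + 1) ^ 2 / (N : ℝ) ^ 2 := by rw [div_pow]
            _ ≤ ((k : ℝ) * ((N : ℝ) + 1)) / (N : ℝ) ^ 2 := by
              gcongr
              nlinarith
            _ = (k : ℝ) * (((N : ℝ) + 1) / (N : ℝ) ^ 2) := by ring
            _ ≤ _ := by gcongr
        linarith

lemma Dist.le_rpow {N : ℕ} (hN : 2 ≤ N) {ρ : ℝ} (hρ0 : 0 < ρ)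
    (hρ1 : ρ ≤ 1 / (N : ℝ) ^ 2) {s : ℝ} (hs0 : 0 < s) (hs : s ≤ 1 / 2) (hρs : ρ ^ s = 1 / N)
    {F : ℝ → ℝ} (hF : Dist N ρ F) {y : ℝ} (hy0 : 0 ≤ y) (hy1 : y ≤ 1) : F y ≤ y ^ s := by
  have hN' : (2 : ℝ) ≤ N := by exact_mod_cast hN
  have ht : Tendsto (fun n : ℕ => y ^ s + (1 / (N : ℝ)) ^ n) atTop (𝓝 (y ^ s + 0)) := by
    refine tendsto_const_nhds.add (tendsto_pow_atTop_nhds_zero_of_lt_one (by positivity) ?_)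
    rw [div_lt_one (by linarith)]; linarith
  rw [add_zero] at ht
  exact ge_of_tendsto' ht fun n => hF.le_rpow_approx hN hρ0 hρ1 hs0 hs hρs n y hy0 hy1

/-- the second comparison, beyond the first gap -/
lemma Dist.le_rpow_shift {N : ℕ} (hN : 2 ≤ N) {ρ : ℝ} (hρ0 : 0 < ρ)
    (hρ1 : ρ ≤ 1 / (N : ℝ) ^ 2) {s : ℝ} (hs0 : 0 < s) (hs : s ≤ 1 / 2) (hρs : ρ ^ s = 1 / N)
    {F : ℝ → ℝ} (hF : Dist N ρ F) {y : ℝ} (hy0 : R N ρ < y) (hy1 : y ≤ 1) :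
    F y ≤ ((y - ρ) / (1 - ρ)) ^ s := by
  obtain ⟨h1, h2, h3, h4, h5⟩ := R_facts hN hρ0 hρ1
  have hN' : (2 : ℝ) ≤ N := by exact_mod_cast hN
  have hN0 : (0 : ℝ) < N := by linarith
  have hR : 0 < R N ρ := by linarith
  have hb0 : 0 < (y - ρ) / (1 - ρ) := div_pos (by linarith) (by linarith)
  have hb1 : (y - ρ) / (1 - ρ) ≤ 1 := by rw [div_le_one (by linarith)]; linarith
  obtain ⟨k, hk, hk0, hk1⟩ := exists_index hN hρ0 hρ1 (by linarith) hy1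
  have hst := hF.step hN hρ0 hρ1 hk hk1
  have hcr := hF.crude hN hρ0 hρ1 hk hk1
  have hkpos : 1 ≤ k := by
    by_contra h
    have : k = 0 := by omega
    subst this
    simp at hk1; linarith
  have hkr : (1 : ℝ) ≤ k := by exact_mod_cast hkpos
  by_cases hkl : k = N - 1
  · have hkc : (k : ℝ) = (N : ℝ) - 1 := by
      rw [hkl, Nat.cast_sub (by omega)]; simp
    rw [hkc, h3] at hst hk0
    have ht0 : 0 ≤ (y - (1 - ρ)) / ρ := div_nonneg (by linarith) hρ0.le
    have ht1 : (y - (1 - ρ)) / ρ ≤ 1 := by rw [div_le_one hρ0]; linarith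
    have ht := hF.le_rpow hN hρ0 hρ1 hs0 hs hρs ht0 ht1
    have hc := concave_bound hN hs0 hs ht0 ht1
      (show 0 ≤ ρ / (1 - ρ) from div_nonneg hρ0.le (by linarith))
      (show ρ / (1 - ρ) ≤ 1 / N by
        rw [div_le_div_iff₀ (by linarith) hN0]; nlinarith)
    have e : 1 - ρ / (1 - ρ) + ρ / (1 - ρ) * ((y - (1 - ρ)) / ρ) = (y - ρ) / (1 - ρ) := by
      have : 1 - ρ ≠ 0 := by linarith
      field_simp; ring
    rw [e] at hc
    have : F ((y - (1 - ρ)) / ρ) / N ≤ ((y - (1 - ρ)) / ρ) ^ s / N := by gcongr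
    linarith
  · have hk2' : k + 2 ≤ N := by omega
    have hk2 : (k : ℝ) + 2 ≤ N := by exact_mod_cast hk2'
    by_cases hN3 : N = 3
    · subst hN3
      have : k = 1 := by omega
      subst this
      push_cast at hst hcr h1 h3 h4 hk0 hk1
      have hρ9 : ρ ≤ 1 / 9 := by linarith
      rcases le_total ((y - 1 * R 3 ρ) / ρ) (2 * R 3 ρ) with ht | ht
      · have h6 := hF.crude hN hρ0 hρ1 (k := 1) (by norm_num) (y := (y - 1 * R 3 ρ) / ρ)
          (by push_cast; linarith)
        push_cast at h6
        have : (5 / 9 : ℝ) ≤ ((y - ρ) / (1 - ρ)) ^ s := by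
          refine le_rpow_of_sq (by norm_num) hb0 hb1 ?_ hs
          rw [le_div_iff₀ (by linarith)]
          linarith
        linarith
      · rw [le_div_iff₀ hρ0] at ht
        refine hcr.trans (le_rpow_of_sq (by norm_num) hb0 hb1 ?_ hs)
        rw [le_div_iff₀ (by linarith)]
        nlinarith
    · refine hcr.trans (le_rpow_of_sq (by positivity) hb0 hb1 ?_ hs)
      have hRl : (k * ((N : ℝ) + 1) - 1) * (1 - ρ) ≤ (N ^ 2 - 1) * (k * R N ρ - ρ) := by
        have : (N ^ 2 - 1) * (k * R N ρ - ρ) = k * (N + 1) * (1 - ρ) - (N ^ 2 - 1) * ρ := by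
          linear_combination k * (N + 1) * h3
        rw [this]; nlinarith
      have hkk : ((k : ℝ) + 1) ^ 2 ≤ k * ((N : ℝ) + 1) - 1 := by
        by_cases hk1' : k = 1
        · subst hk1'
          have : (4 : ℝ) ≤ N := by
            have : 4 ≤ N := by omega
            exact_mod_cast this
          push_cast; linarith
        · have : (2 : ℝ) ≤ k := by
            have : 2 ≤ k := by omega
            exact_mod_cast this
          nlinarith
      have hD : (0 : ℝ) < N ^ 2 - 1 := by nlinarith
      calc (((k : ℝ) + 1) / N) ^ 2 = (k + 1) ^ 2 / N ^ 2 := by rw [div_pow]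
        _ ≤ (k * ((N : ℝ) + 1) - 1) / (N ^ 2 - 1) := by
          have : (0 : ℝ) ≤ k * ((N : ℝ) + 1) - 1 := by nlinarith
          gcongr
          linarith
        _ ≤ (k * R N ρ - ρ) / (1 - ρ) := by
          rw [div_le_div_iff₀ hD (by linarith)]
          linarith
        _ ≤ _ := by
          gcongr
          linarith

lemma left_part (N : ℕ) (hN : 2 ≤ N) (ρ : ℝ) (hρ0 : 0 < ρ)
    (hρ1 : ρ ≤ 1 / (N : ℝ) ^ 2) (s : ℝ) (hs : s = -Real.log N / Real.log ρ)
    (μ : Measure ℝ) (hprob : IsProbabilityMeasure μ) (hss : IsSelfSimilar N ρ μ) :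
    (∀ x ∈ Icc (0 : ℝ) ρ,
      (x ≤ ρ / 2 →
        (∀ r : ℝ, max x (ρ - x) ≤ r → r ≤ 1 - x →
          (μ (Ioo (x - r) (x + r))).toReal / (2 * r) ^ s ≤
            ρ ^ s / ((2 : ℝ) ^ s * (ρ - x) ^ s)) ∧
        (∃ r : ℝ, max x (ρ - x) ≤ r ∧ r ≤ 1 - x ∧
          (μ (Ioo (x - r) (x + r))).toReal / (2 * r) ^ s =
            ρ ^ s / ((2 : ℝ) ^ s * (ρ - x) ^ s))) ∧
      (ρ / 2 ≤ x →
        (∀ r : ℝ, max x (ρ - x) ≤ r → r ≤ 1 - x →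
          (μ (Ioo (x - r) (x + r))).toReal / (2 * r) ^ s ≤
            max (ρ ^ s / ((2 : ℝ) ^ s * x ^ s)) (1 / ((2 : ℝ) ^ s * (1 - x) ^ s))) ∧
        (∃ r : ℝ, max x (ρ - x) ≤ r ∧ r ≤ 1 - x ∧
          (μ (Ioo (x - r) (x + r))).toReal / (2 * r) ^ s =
            max (ρ ^ s / ((2 : ℝ) ^ s * x ^ s)) (1 / ((2 : ℝ) ^ s * (1 - x) ^ s))))) := by
  obtain ⟨h1, h2, h3, h4, h5⟩ := R_facts hN hρ0 hρ1
  obtain ⟨hs0, hs2, hρs⟩ := s_facts hN hρ0 hρ1 hs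
  have hF := dist_of_selfsim hN hρ0 hρ1 hss
  set F : ℝ → ℝ := fun y => μ.real (Iio y) with hFdef
  have hle : ∀ a b, (μ (Ioo a b)).toReal ≤ F b := fun a b =>
    measureReal_mono (fun z hz => hz.2)
  have heq : ∀ a b, a ≤ 0 → (μ (Ioo a b)).toReal = F b := by
    intro a b ha
    refine le_antisymm (hle a b) ?_
    have h0 := real_Iic_zero hN hρ0 hρ1 hss
    have hsub : Iio b ⊆ Ioo a b ∪ Iic 0 := by
      intro z hz
      rcases le_or_gt z 0 with h | h
      · exact Or.inr h
      · exact Or.inl ⟨by linarith, hz⟩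
    calc F b ≤ μ.real (Ioo a b ∪ Iic 0) := measureReal_mono hsub
      _ ≤ μ.real (Ioo a b) + μ.real (Iic 0) := measureReal_union_le _ _
      _ = _ := by rw [h0, add_zero]; rfl
  rintro x ⟨hx0, hxρ⟩
  have h2s : (0 : ℝ) < 2 ^ s := by positivity
  refine ⟨fun hx2 => ⟨fun r hr1 hr2 => ?_, ρ - x, ?_, by linarith, ?_⟩,
    fun hx2 => ⟨fun r hr1 hr2 => ?_, ?_⟩⟩
  · have hrx := (le_max_left _ _).trans hr1
    have hrx' := (le_max_right _ _).trans hr1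
    have hr0 : 0 < r := by linarith
    have hρx : 0 < ρ - x := by linarith
    have hb : F (x + r) ≤ (x + r) ^ s :=
      hF.le_rpow hN hρ0 hρ1 hs0 hs2 hρs (by linarith) (by linarith)
    have hxr : 0 < x + r := by linarith
    calc _ ≤ (x + r) ^ s / (2 * r) ^ s := by
          gcongr; exact (hle _ _).trans hb
      _ = ((x + r) / (2 * r)) ^ s := by rw [Real.div_rpow (by linarith) (by linarith)]
      _ ≤ (ρ / (2 * (ρ - x))) ^ s := by
          apply Real.rpow_le_rpow (by positivity) _ hs0.le
          rw [div_le_div_iff₀ (by linarith) (by linarith)]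
          nlinarith
      _ = _ := by
          rw [Real.div_rpow hρ0.le (by linarith), Real.mul_rpow (by norm_num) hρx.le]
  · exact max_le (by linarith) le_rfl
  · rw [heq _ _ (by linarith), hF.first hN hρ0 hρ1 (by linarith) (by linarith),
      Real.mul_rpow (by norm_num) (by linarith), hρs]
  · have hrx := (le_max_left _ _).trans hr1
    have hxp : 0 < x := by linarith
    have hr0 : 0 < r := by linarith
    have hx1 : 0 < 1 - x := by linarith
    rcases le_or_gt (x + r) (R N ρ) with hy | hy
    · refine le_trans ?_ (le_max_left _ _)
      have := hF.first hN hρ0 hρ1 (y := x + r) (by linarith) hy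
      rw [hρs, ← Real.mul_rpow (by norm_num) hxp.le, ← this]
      have h0 : 0 ≤ F (x + r) := measureReal_nonneg
      gcongr
      exact hle _ _
    · refine le_trans ?_ (le_max_right _ _)
      have hb := hF.le_rpow_shift hN hρ0 hρ1 hs0 hs2 hρs hy (by linarith)
      calc _ ≤ (r / (1 - x)) ^ s / (2 * r) ^ s := by
            gcongr
            refine (hle _ _).trans (hb.trans ?_)
            apply Real.rpow_le_rpow (div_nonneg (by linarith) (by linarith)) _ hs0.le
            rw [div_le_div_iff₀ (by linarith) (by linarith)]
            nlinarith
        _ = _ := by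
            rw [Real.div_rpow hr0.le hx1.le, Real.mul_rpow (by norm_num) hr0.le]
            have : 0 < r ^ s := by positivity
            have : 0 < (1 - x) ^ s := by positivity
            field_simp
  · rcases le_total (ρ ^ s / ((2 : ℝ) ^ s * x ^ s)) (1 / ((2 : ℝ) ^ s * (1 - x) ^ s)) with h | h
    · refine ⟨1 - x, max_le (by linarith) (by linarith), le_rfl, ?_⟩
      rw [max_eq_right h, heq _ _ (by linarith), hF.one _ (by linarith),
        Real.mul_rpow (by norm_num) (by linarith)]
    · refine ⟨x, max_le (by linarith) (by linarith), by linarith, ?_⟩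
      rw [max_eq_left h, heq _ _ (by linarith), hF.first hN hρ0 hρ1 (by linarith) (by linarith),
        Real.mul_rpow (by norm_num) (by linarith), hρs]

/-- Lemma 2.6: upper bounds for `μ(B(x,r))/(2r)^s` near the two extreme level-1 pieces,
with attainment of the bound for some admissible `r`. -/
theorem upper_bound_extreme_pieces (N : ℕ) (hN : 2 ≤ N) (ρ : ℝ) (hρ0 : 0 < ρ)
    (hρ1 : ρ ≤ 1 / (N : ℝ) ^ 2) (s : ℝ) (hs : s = -Real.log N / Real.log ρ)
    (μ : Measure ℝ) (hprob : IsProbabilityMeasure μ) (hss : IsSelfSimilar N ρ μ) :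
    (∀ x ∈ Icc (0 : ℝ) ρ,
      (x ≤ ρ / 2 →
        (∀ r : ℝ, max x (ρ - x) ≤ r → r ≤ 1 - x →
          (μ (Ioo (x - r) (x + r))).toReal / (2 * r) ^ s ≤
            ρ ^ s / ((2 : ℝ) ^ s * (ρ - x) ^ s)) ∧
        (∃ r : ℝ, max x (ρ - x) ≤ r ∧ r ≤ 1 - x ∧
          (μ (Ioo (x - r) (x + r))).toReal / (2 * r) ^ s =
            ρ ^ s / ((2 : ℝ) ^ s * (ρ - x) ^ s))) ∧
      (ρ / 2 ≤ x →
        (∀ r : ℝ, max x (ρ - x) ≤ r → r ≤ 1 - x →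
          (μ (Ioo (x - r) (x + r))).toReal / (2 * r) ^ s ≤
            max (ρ ^ s / ((2 : ℝ) ^ s * x ^ s)) (1 / ((2 : ℝ) ^ s * (1 - x) ^ s))) ∧
        (∃ r : ℝ, max x (ρ - x) ≤ r ∧ r ≤ 1 - x ∧
          (μ (Ioo (x - r) (x + r))).toReal / (2 * r) ^ s =
            max (ρ ^ s / ((2 : ℝ) ^ s * x ^ s)) (1 / ((2 : ℝ) ^ s * (1 - x) ^ s))))) ∧
    (∀ x ∈ Icc (1 - ρ) (1 : ℝ),
      (x ≤ 1 - ρ / 2 →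
        (∀ r : ℝ, max (1 - x) (ρ - (1 - x)) ≤ r → r ≤ x →
          (μ (Ioo (x - r) (x + r))).toReal / (2 * r) ^ s ≤
            max (ρ ^ s / ((2 : ℝ) ^ s * (1 - x) ^ s)) (1 / ((2 : ℝ) ^ s * x ^ s))) ∧
        (∃ r : ℝ, max (1 - x) (ρ - (1 - x)) ≤ r ∧ r ≤ x ∧
          (μ (Ioo (x - r) (x + r))).toReal / (2 * r) ^ s =
            max (ρ ^ s / ((2 : ℝ) ^ s * (1 - x) ^ s)) (1 / ((2 : ℝ) ^ s * x ^ s)))) ∧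
      (1 - ρ / 2 ≤ x →
        (∀ r : ℝ, max (1 - x) (ρ - (1 - x)) ≤ r → r ≤ x →
          (μ (Ioo (x - r) (x + r))).toReal / (2 * r) ^ s ≤
            ρ ^ s / ((2 : ℝ) ^ s * (ρ - (1 - x)) ^ s)) ∧
        (∃ r : ℝ, max (1 - x) (ρ - (1 - x)) ≤ r ∧ r ≤ x ∧
          (μ (Ioo (x - r) (x + r))).toReal / (2 * r) ^ s =
            ρ ^ s / ((2 : ℝ) ^ s * (ρ - (1 - x)) ^ s)))) := by
  refine ⟨left_part N hN ρ hρ0 hρ1 s hs μ hprob hss, ?_⟩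
  rintro x ⟨hx0, hx1⟩
  have hr : Measurable (fun x : ℝ => 1 - x) := by fun_prop
  have hp : IsProbabilityMeasure (μ.map (fun x => 1 - x)) :=
    Measure.isProbabilityMeasure_map hr.aemeasurable
  have hL := left_part N hN ρ hρ0 hρ1 s hs _ hp (selfsim_reflect hN hss) (1 - x)
    ⟨by linarith, by linarith⟩
  have hball : ∀ r, (μ.map (fun x => 1 - x)) (Ioo (1 - x - r) (1 - x + r)) =
      μ (Ioo (x - r) (x + r)) := by
    intro r
    rw [Measure.map_apply hr measurableSet_Ioo]
    congr 1
    ext z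
    simp only [mem_preimage, mem_Ioo]
    constructor <;> rintro ⟨h1, h2⟩ <;> constructor <;> linarith
  simp only [hball, _root_.sub_sub_cancel] at hL
  exact ⟨fun h => hL.2 (by linarith), fun h => hL.1 (by linarith)⟩

end HomogeneousCantorDensity
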